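/- arXiv:1403.2845 — 5 statements merged into one kernel-verified Lean document; each statement's English description precedes it below -/
import Mathlib

section
/- Projection property of the Lance–Williams method (Lemma 3.1): suppose that at every step the parameters satisfy α_I, α_J ≥ 0, α_I + α_J = 1, β = 0 and |γ| ≤ min(α_I, α_J) (this covers the group average method, the nearest neighbor method, and the furthest neighbor method). Then the Lance–Williams map τ is a projection: τ(τ(d_H)) = τ(d_H) for every input d_H. -/
open MeasureTheory ProbabilityTheory Filter Matrix
open scoped RealInnerProductSpace

noncomputable section

/-- Parameters of the Lance–Williams update rule, as functions of the cluster
sizes `n_I`, `n_J`, `n_K`. -/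
structure LWParams where
  αI : ℕ → ℕ → ℕ → ℝ
  αJ : ℕ → ℕ → ℕ → ℝ
  β  : ℕ → ℕ → ℕ → ℝ
  γ  : ℕ → ℕ → ℕ → ℝ

/-- State of the Lance–Williams algorithm: current list of clusters, current
inter-cluster distance, and the output matrix recorded so far. -/
structure LWState (M : ℕ) where
  clusters : List (Finset (Fin M))
  dist : Finset (Fin M) → Finset (Fin M) → ℝ
  out : Fin M → Fin M → ℝ

/-- All unordered pairs of elements of a list (each pair listed once, in list order). -/
def pairsOf {α : Type*} : List α → List (α × α)
  | [] => []
  | a :: l => (l.map fun b => (a, b)) ++ pairsOf l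

/-- One merge step of the Lance–Williams algorithm: pick the (first) pair of clusters at
minimal distance, record the merge height into the output matrix, and update the
inter-cluster distances by the Lance–Williams formula. -/
def lwStep {M : ℕ} (p : LWParams) (s : LWState M) : LWState M :=
  match (pairsOf s.clusters).argmin (fun q => s.dist q.1 q.2) with
  | none => s
  | some q =>
    let I := q.1
    let J := q.2
    { clusters := (I ∪ J) :: ((s.clusters.erase I).erase J)
      dist := fun A B =>
        if A = I ∪ J ∧ B = I ∪ J then 0
        else if A = I ∪ J then
          p.αI I.card J.card B.card * s.dist I B + p.αJ I.card J.card B.card * s.dist J B +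
            p.β I.card J.card B.card * s.dist I J +
            p.γ I.card J.card B.card * |s.dist I B - s.dist J B|
        else if B = I ∪ J then
          p.αI I.card J.card A.card * s.dist I A + p.αJ I.card J.card A.card * s.dist J A +
            p.β I.card J.card A.card * s.dist I J +
            p.γ I.card J.card A.card * |s.dist I A - s.dist J A|
        else s.dist A B
      out := fun i j => if (i ∈ I ∧ j ∈ J) ∨ (i ∈ J ∧ j ∈ I) then s.dist I J else s.out i j }

/-- Initial state: singletons, with the input dissimilarity. -/
def lwInit (M : ℕ) (dH : Fin M → Fin M → ℝ) : LWState M :=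
  { clusters := (List.finRange M).map fun i => {i}
    dist := fun A B => ∑ i ∈ A, ∑ j ∈ B, dH i j
    out := dH }

/-- The state after running all `M - 1` merge steps. -/
def lwRun (M : ℕ) (p : LWParams) (dH : Fin M → Fin M → ℝ) : LWState M :=
  (lwStep p)^[M - 1] (lwInit M dH)

/-- The Lance–Williams map `τ`: the output matrix `d_T` of the algorithm. -/
def lwTau (M : ℕ) (p : LWParams) (dH : Fin M → Fin M → ℝ) : Fin M → Fin M → ℝ :=
  fun i j => if i = j then 0 else (lwRun M p dH).out i j

/-- The algorithm run on `dH` has a strictly unique minimizing pair at every merge step. -/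
def lwNoTies (M : ℕ) (p : LWParams) (dH : Fin M → Fin M → ℝ) : Prop :=
  ∀ k < M - 1,
    ∃ q ∈ pairsOf ((lwStep p)^[k] (lwInit M dH)).clusters,
      ∀ r ∈ pairsOf ((lwStep p)^[k] (lwInit M dH)).clusters, r ≠ q →
        ((lwStep p)^[k] (lwInit M dH)).dist q.1 q.2 < ((lwStep p)^[k] (lwInit M dH)).dist r.1 r.2

/-- `dH` is a symmetric nonnegative matrix with zero diagonal. -/
def IsDissim (M : ℕ) (dH : Fin M → Fin M → ℝ) : Prop :=
  (∀ i j, 0 ≤ dH i j) ∧ (∀ i, dH i i = 0) ∧ (∀ i j, dH i j = dH j i)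

/-- The parameter conditions `α_I, α_J ≥ 0`, `α_I + α_J = 1`, `β = 0`,
`|γ| ≤ min(α_I, α_J)` at every step. -/
def LWConvexParams (p : LWParams) : Prop :=
  ∀ nI nJ nK, 0 ≤ p.αI nI nJ nK ∧ 0 ≤ p.αJ nI nJ nK ∧
    p.αI nI nJ nK + p.αJ nI nJ nK = 1 ∧ p.β nI nJ nK = 0 ∧
    |p.γ nI nJ nK| ≤ min (p.αI nI nJ nK) (p.αJ nI nJ nK)

/-- The state obtained from `s` by merging the clusters `I` and `J`. -/
def LWState.merge {M : ℕ} (p : LWParams) (s : LWState M) (I J : Finset (Fin M)) : LWState M where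
  clusters := (I ∪ J) :: ((s.clusters.erase I).erase J)
  dist := fun A B =>
    if A = I ∪ J ∧ B = I ∪ J then 0
    else if A = I ∪ J then
      p.αI I.card J.card B.card * s.dist I B + p.αJ I.card J.card B.card * s.dist J B +
        p.β I.card J.card B.card * s.dist I J +
        p.γ I.card J.card B.card * |s.dist I B - s.dist J B|
    else if B = I ∪ J then
      p.αI I.card J.card A.card * s.dist I A + p.αJ I.card J.card A.card * s.dist J A +
        p.β I.card J.card A.card * s.dist I J +
        p.γ I.card J.card A.card * |s.dist I A - s.dist J A|
    else s.dist A B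
  out := fun i j => if (i ∈ I ∧ j ∈ J) ∨ (i ∈ J ∧ j ∈ I) then s.dist I J else s.out i j

theorem pairwise_iff_forall_mem_pairsOf {α : Type*} {R : α → α → Prop} (l : List α) :
    l.Pairwise R ↔ ∀ q ∈ pairsOf l, R q.1 q.2 := by
  induction l with
  | nil => simp [pairsOf]
  | cons a l ih =>
    simp only [List.pairwise_cons, ih, pairsOf, List.mem_append, List.mem_map]
    constructor
    · rintro ⟨h₁, h₂⟩ q (⟨b, hb, rfl⟩ | hq)
      · exact h₁ b hb
      · exact h₂ q hq
    · intro h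
      exact ⟨fun b hb => h (a, b) (Or.inl ⟨b, hb, rfl⟩), fun q hq => h q (Or.inr hq)⟩

theorem sublist_of_mem_pairsOf {α : Type*} {l : List α} {q : α × α} (h : q ∈ pairsOf l) :
    [q.1, q.2].Sublist l := by
  induction l with
  | nil => simp [pairsOf] at h
  | cons a l ih =>
    simp only [pairsOf, List.mem_append, List.mem_map] at h
    rcases h with ⟨b, hb, rfl⟩ | h
    · exact (List.singleton_sublist.2 hb).cons_cons a
    · exact (ih h).cons a

theorem length_le_one_of_pairsOf_eq_nil {α : Type*} {l : List α} (h : pairsOf l = []) :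
    l.length ≤ 1 := by
  match l with
  | [] => simp
  | [_] => simp
  | a :: b :: l => simp [pairsOf] at h

/-- A step either finds at most one cluster and does nothing, or merges a closest pair. -/
theorem lwStep_eq_self_or_merge {M : ℕ} (p : LWParams) (s : LWState M) :
    (s.clusters.length ≤ 1 ∧ lwStep p s = s) ∨
      ∃ I J r, s.clusters.Perm (I :: J :: r) ∧
        s.clusters.Pairwise (fun A B => s.dist I J ≤ s.dist A B) ∧
        ((s.clusters.erase I).erase J).Perm r ∧ lwStep p s = s.merge p I J := by
  cases h : (pairsOf s.clusters).argmin (fun q => s.dist q.1 q.2) with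
  | none =>
    refine Or.inl ⟨length_le_one_of_pairsOf_eq_nil (List.argmin_eq_none.1 h), ?_⟩
    simp only [lwStep, h]
  | some q =>
    right
    obtain ⟨r, hr⟩ := (sublist_of_mem_pairsOf (List.argmin_mem h)).exists_perm_append
    refine ⟨q.1, q.2, r, hr, ?_, ?_, ?_⟩
    · exact (pairwise_iff_forall_mem_pairsOf _).2 fun t ht => List.le_of_mem_argmin ht h
    · simpa using (hr.erase q.1).erase q.2
    · simp only [lwStep, h, LWState.merge]

/-- The clusters form a partition and the inter-cluster distance is symmetric. -/
structure LWState.IsPartition {M : ℕ} (s : LWState M) : Prop where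
  nonempty : ∀ A ∈ s.clusters, A.Nonempty
  disjoint : s.clusters.Pairwise Disjoint
  cover : ∀ i, ∃ A ∈ s.clusters, i ∈ A
  symm : ∀ A B, s.dist A B = s.dist B A

theorem lwInit_isPartition {M : ℕ} {d : Fin M → Fin M → ℝ} (hd : ∀ i j, d i j = d j i) :
    (lwInit M d).IsPartition where
  nonempty := by simp [lwInit]
  disjoint := by
    simp only [lwInit, List.pairwise_map, Finset.disjoint_singleton]
    exact List.nodup_finRange M
  cover := by simp [lwInit]
  symm A B := by
    simp only [lwInit]
    rw [Finset.sum_comm]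
    simp only [hd]

section Merge

variable {M : ℕ} {p : LWParams} {s : LWState M} {I J : Finset (Fin M)} {r : List (Finset (Fin M))}

theorem LWState.merge_clusters_perm (her : ((s.clusters.erase I).erase J).Perm r) :
    (s.merge p I J).clusters.Perm ((I ∪ J) :: r) :=
  her.cons _

theorem LWState.merge_dist_union {K : Finset (Fin M)} (hK : K ≠ I ∪ J) :
    (s.merge p I J).dist (I ∪ J) K =
      p.αI I.card J.card K.card * s.dist I K + p.αJ I.card J.card K.card * s.dist J K +
        p.β I.card J.card K.card * s.dist I J +
        p.γ I.card J.card K.card * |s.dist I K - s.dist J K| := by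
  simp [LWState.merge, hK]

theorem LWState.merge_dist_of_ne {A B : Finset (Fin M)} (hA : A ≠ I ∪ J) (hB : B ≠ I ∪ J) :
    (s.merge p I J).dist A B = s.dist A B := by
  simp [LWState.merge, hA, hB]

theorem LWState.IsPartition.pairwise_cons_cons (hs : s.IsPartition)
    (hr : s.clusters.Perm (I :: J :: r)) :
    Disjoint I J ∧ (∀ K ∈ r, Disjoint I K) ∧ (∀ K ∈ r, Disjoint J K) ∧ r.Pairwise Disjoint := by
  have h := hs.disjoint.perm hr fun h => h.symm
  simp only [List.pairwise_cons, List.mem_cons, forall_eq_or_imp] at h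
  tauto

theorem LWState.IsPartition.ne_union (hs : s.IsPartition) (hr : s.clusters.Perm (I :: J :: r))
    {K : Finset (Fin M)} (hK : K ∈ r) : K ≠ I ∪ J := by
  rintro rfl
  obtain ⟨-, hI, hJ, -⟩ := hs.pairwise_cons_cons hr
  have h := Finset.disjoint_union_left.2 ⟨hI _ hK, hJ _ hK⟩
  obtain ⟨i, hi⟩ := hs.nonempty (I ∪ J) (hr.mem_iff.2 (by simp [hK]))
  exact Finset.disjoint_left.1 h hi hi

theorem LWState.IsPartition.merge (hs : s.IsPartition) (hr : s.clusters.Perm (I :: J :: r))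
    (her : ((s.clusters.erase I).erase J).Perm r) : (s.merge p I J).IsPartition where
  nonempty A hA := by
    rw [(merge_clusters_perm her).mem_iff, List.mem_cons] at hA
    rcases hA with rfl | hA
    · exact (hs.nonempty I (hr.mem_iff.2 (by simp))).mono Finset.subset_union_left
    · exact hs.nonempty A (hr.mem_iff.2 (by simp [hA]))
  disjoint := by
    refine List.Pairwise.perm ?_ (merge_clusters_perm her).symm fun h => h.symm
    obtain ⟨-, hI, hJ, h⟩ := hs.pairwise_cons_cons hr
    exact List.pairwise_cons.2 ⟨fun K hK => Finset.disjoint_union_left.2 ⟨hI K hK, hJ K hK⟩, h⟩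
  cover i := by
    obtain ⟨A, hA, hi⟩ := hs.cover i
    rw [hr.mem_iff] at hA
    simp only [List.mem_cons] at hA
    rcases hA with rfl | rfl | hA
    · exact ⟨_, (merge_clusters_perm her).mem_iff.2 List.mem_cons_self, by simp [hi]⟩
    · exact ⟨_, (merge_clusters_perm her).mem_iff.2 List.mem_cons_self, by simp [hi]⟩
    · exact ⟨A, (merge_clusters_perm her).mem_iff.2 (List.mem_cons_of_mem _ hA), hi⟩
  symm A B := by
    by_cases hA : A = I ∪ J <;> by_cases hB : B = I ∪ J <;>
      simp [LWState.merge, hA, hB, hs.symm A B]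

end Merge

/-- With convex parameters, the updated distance is at least the smaller of the old ones. -/
theorem LWConvexParams.le_update {p : LWParams} (hp : LWConvexParams p) (a b c : ℕ)
    {h x y z : ℝ} (hx : h ≤ x) (hy : h ≤ y) :
    h ≤ p.αI a b c * x + p.αJ a b c * y + p.β a b c * z + p.γ a b c * |x - y| := by
  obtain ⟨-, -, h₁, hβ, hγ⟩ := hp a b c
  obtain ⟨hI, hJ⟩ := le_min_iff.1 hγ
  obtain ⟨hI₁, hI₂⟩ := abs_le.1 hI
  obtain ⟨hJ₁, hJ₂⟩ := abs_le.1 hJ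
  have hsum : h = p.αI a b c * h + p.αJ a b c * h := by rw [← add_mul, h₁, one_mul]
  rw [hβ]
  rcases abs_cases (x - y) with ⟨e, -⟩ | ⟨e, -⟩ <;> rw [e]
  · nlinarith [mul_nonneg (by linarith : 0 ≤ p.αI a b c + p.γ a b c) (sub_nonneg.2 hx),
      mul_nonneg (by linarith : 0 ≤ p.αJ a b c - p.γ a b c) (sub_nonneg.2 hy)]
  · nlinarith [mul_nonneg (by linarith : 0 ≤ p.αI a b c - p.γ a b c) (sub_nonneg.2 hx),
      mul_nonneg (by linarith : 0 ≤ p.αJ a b c + p.γ a b c) (sub_nonneg.2 hy)]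

/-- The strong triangle inequality for triples of distinct points. -/
def IsUltrametricOffDiag {ι : Type*} (u : ι → ι → ℝ) : Prop :=
  ∀ i j k, i ≠ j → j ≠ k → i ≠ k → u i k ≤ max (u i j) (u j k)

/-- The inter-cluster distances and the recorded output both agree with `u`. -/
structure LWState.Represents {M : ℕ} (s : LWState M) (u : Fin M → Fin M → ℝ) : Prop
    extends s.IsPartition where
  dist_eq : s.clusters.Pairwise fun A B => ∀ i ∈ A, ∀ j ∈ B, s.dist A B = u i j
  out_eq : ∀ i j, i ≠ j → s.out i j = u i j

theorem lwInit_represents {M : ℕ} {u : Fin M → Fin M → ℝ} (hu : ∀ i j, u i j = u j i) :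
    (lwInit M u).Represents u where
  toIsPartition := lwInit_isPartition hu
  dist_eq := by
    simp only [lwInit, List.pairwise_map]
    exact List.pairwise_of_forall (by simp)
  out_eq _ _ _ := rfl

theorem LWState.Represents.lwStep {M : ℕ} {p : LWParams} (hp : LWConvexParams p)
    {s : LWState M} {u : Fin M → Fin M → ℝ} (hsymm : ∀ i j, u i j = u j i)
    (hu : IsUltrametricOffDiag u) (hs : s.Represents u) : (lwStep p s).Represents u := by
  rcases lwStep_eq_self_or_merge p s with ⟨-, h⟩ | ⟨I, J, r, hr, hmin, her, h⟩
  · rwa [h]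
  rw [h]
  have hP := hs.toIsPartition
  obtain ⟨dIJ, dI, dJ, -⟩ := hP.pairwise_cons_cons hr
  have hd := hs.dist_eq.perm hr fun {A B} h i hi j hj => by
    rw [hP.symm B A, h j hj i hi, hsymm]
  have hm := hmin.perm hr fun {A B} h => by rwa [hP.symm B A]
  simp only [List.pairwise_cons, List.mem_cons, forall_eq_or_imp] at hd hm
  obtain ⟨⟨eIJ, eI⟩, eJ, er⟩ := hd
  obtain ⟨⟨-, mI⟩, mJ, -⟩ := hm
  refine ⟨hP.merge hr her, ?_, ?_⟩
  · refine List.Pairwise.perm ?_ (merge_clusters_perm her).symm fun {A B} h i hi j hj => by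
      rw [(hP.merge hr her).symm B A, h j hj i hi, hsymm]
    refine List.pairwise_cons.2 ⟨fun K hK => ?_, ?_⟩
    · intro x hx k hk
      obtain ⟨i, hi⟩ := hP.nonempty I (hr.mem_iff.2 (by simp))
      obtain ⟨j, hj⟩ := hP.nonempty J (hr.mem_iff.2 (by simp))
      have hij : i ≠ j := Finset.disjoint_iff_ne.1 dIJ i hi j hj
      have hik : i ≠ k := Finset.disjoint_iff_ne.1 (dI K hK) i hi k hk
      have hjk : j ≠ k := Finset.disjoint_iff_ne.1 (dJ K hK) j hj k hk
      have hIK : s.dist I K = s.dist J K := by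
        have h₁ := hu i j k hij hjk hik
        have h₂ := hu j i k hij.symm hik hjk
        rw [hsymm j i] at h₂
        rw [← eIJ i hi j hj, ← eI K hK i hi k hk, ← eJ K hK j hj k hk] at h₁ h₂
        rw [max_eq_right (mJ K hK)] at h₁
        rw [max_eq_right (mI K hK)] at h₂
        exact le_antisymm h₁ h₂
      have hx' : s.dist I K = u x k := by
        rcases Finset.mem_union.1 hx with hx | hx
        · exact eI K hK x hx k hk
        · rw [hIK]; exact eJ K hK x hx k hk
      obtain ⟨-, -, h₁, hβ, -⟩ := hp I.card J.card K.card
      rw [merge_dist_union (hP.ne_union hr hK), ← hIK, hβ, ← hx', ← add_mul, h₁]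
      simp
    · refine er.imp_of_mem fun {A B} hA hB h => ?_
      rwa [merge_dist_of_ne (hP.ne_union hr hA) (hP.ne_union hr hB)]
  · intro i j hij
    simp only [LWState.merge]
    split_ifs with h
    · rcases h with ⟨hi, hj⟩ | ⟨hi, hj⟩
      · exact eIJ i hi j hj
      · rw [eIJ j hj i hi, hsymm]
    · exact hs.out_eq i j hij

/-- The Lance–Williams map fixes every symmetric ultrametric. -/
theorem lwTau_eq_self {M : ℕ} {p : LWParams} (hp : LWConvexParams p) {u : Fin M → Fin M → ℝ}
    (hzero : ∀ i, u i i = 0) (hsymm : ∀ i j, u i j = u j i) (hu : IsUltrametricOffDiag u) :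
    lwTau M p u = u := by
  have h : ∀ n, ((lwStep p)^[n] (lwInit M u)).Represents u := fun n => by
    induction n with
    | zero => exact lwInit_represents hsymm
    | succ n ih => rw [Function.iterate_succ_apply']; exact ih.lwStep hp hsymm hu
  funext i j
  by_cases hij : i = j
  · simp [lwTau, hij, hzero]
  · simpa [lwTau, lwRun, hij] using (h (M - 1)).out_eq i j hij

/-- The output is a symmetric ultrametric within each cluster, bounded by a height `h` below
which no two clusters are close. -/
structure LWState.IsDendrogram {M : ℕ} (s : LWState M) (h : ℝ) : Prop
    extends s.IsPartition where
  le_dist : s.clusters.Pairwise fun A B => h ≤ s.dist A B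
  out_le : ∀ A ∈ s.clusters, ∀ i ∈ A, ∀ j ∈ A, i ≠ j → s.out i j ≤ h
  out_symm : ∀ i j, s.out i j = s.out j i
  ultra : ∀ A ∈ s.clusters, ∀ i ∈ A, ∀ j ∈ A, ∀ k ∈ A, i ≠ j → j ≠ k → i ≠ k →
    s.out i k ≤ max (s.out i j) (s.out j k)

theorem lwInit_isDendrogram {M : ℕ} {d : Fin M → Fin M → ℝ} (hd : IsDissim M d) :
    (lwInit M d).IsDendrogram 0 where
  toIsPartition := lwInit_isPartition hd.2.2
  le_dist := List.pairwise_of_forall fun _ _ =>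
    Finset.sum_nonneg fun i _ => Finset.sum_nonneg fun j _ => hd.1 i j
  out_le := by
    simp only [lwInit, List.mem_map]
    rintro _ ⟨a, -, rfl⟩ i hi j hj hij
    simp_all
  out_symm := hd.2.2
  ultra := by
    simp only [lwInit, List.mem_map]
    rintro _ ⟨a, -, rfl⟩ i hi j hj k hk hij
    simp_all

theorem LWState.IsDendrogram.lwStep {M : ℕ} {p : LWParams} (hp : LWConvexParams p)
    {s : LWState M} {h : ℝ} (hs : s.IsDendrogram h) : ∃ h', (lwStep p s).IsDendrogram h' := by
  rcases lwStep_eq_self_or_merge p s with ⟨-, e⟩ | ⟨I, J, r, hr, hmin, her, e⟩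
  · exact ⟨h, by rwa [e]⟩
  rw [e]
  have hP := hs.toIsPartition
  obtain ⟨dIJ, dI, dJ, -⟩ := hP.pairwise_cons_cons hr
  have hd := hs.le_dist.perm hr fun {A B} h => by rwa [hP.symm B A]
  have hm := hmin.perm hr fun {A B} h => by rwa [hP.symm B A]
  simp only [List.pairwise_cons, List.mem_cons, forall_eq_or_imp] at hd hm
  obtain ⟨⟨hle, -⟩, -⟩ := hd
  obtain ⟨⟨-, mI⟩, mJ, mr⟩ := hm
  have hI : I ∈ s.clusters := hr.mem_iff.2 (by simp)
  have hJ : J ∈ s.clusters := hr.mem_iff.2 (by simp)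
  have hK : ∀ K ∈ r, K ∈ s.clusters := fun K hK => hr.mem_iff.2 (by simp [hK])
  have nIJ : ∀ i ∈ I, i ∉ J := fun i hi => Finset.disjoint_left.1 dIJ hi
  have out_same : ∀ A ∈ s.clusters, A = I ∨ A = J ∨ A ∈ r → ∀ i ∈ A, ∀ j ∈ A,
      (s.merge p I J).out i j = s.out i j := by
    intro A _ hA i hi j hj
    have : ¬((i ∈ I ∧ j ∈ J) ∨ (i ∈ J ∧ j ∈ I)) := by
      rcases hA with rfl | rfl | hA
      · grind
      · grind
      · have h₁ := Finset.disjoint_right.1 (dI A hA) hi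
        have h₂ := Finset.disjoint_right.1 (dJ A hA) hi
        tauto
    simp only [LWState.merge, if_neg this]
  have out_cross : ∀ i j, (i ∈ I ∧ j ∈ J) ∨ (i ∈ J ∧ j ∈ I) →
      (s.merge p I J).out i j = s.dist I J := fun i j hij => by
    simp only [LWState.merge, if_pos hij]
  have out_le : ∀ i ∈ I ∪ J, ∀ j ∈ I ∪ J, i ≠ j → (s.merge p I J).out i j ≤ s.dist I J := by
    intro i hi j hj hij
    rcases Finset.mem_union.1 hi with hi | hi <;> rcases Finset.mem_union.1 hj with hj | hj
    · rw [out_same I hI (by simp) i hi j hj]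
      exact (hs.out_le I hI i hi j hj hij).trans hle
    · exact (out_cross i j (by tauto)).le
    · exact (out_cross i j (by tauto)).le
    · rw [out_same J hJ (by simp) i hi j hj]
      exact (hs.out_le J hJ i hi j hj hij).trans hle
  refine ⟨s.dist I J, hP.merge hr her, ?_, ?_, ?_, ?_⟩
  · refine List.Pairwise.perm ?_ (merge_clusters_perm her).symm fun {A B} h => by
      rwa [(hP.merge hr her).symm B A]
    refine List.pairwise_cons.2 ⟨fun K hK => ?_, mr.imp_of_mem fun {A B} hA hB h => ?_⟩
    · rw [merge_dist_union (hP.ne_union hr hK)]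
      exact hp.le_update _ _ _ (mI K hK) (mJ K hK)
    · rwa [merge_dist_of_ne (hP.ne_union hr hA) (hP.ne_union hr hB)]
  · intro A hA i hi j hj hij
    rw [(merge_clusters_perm her).mem_iff, List.mem_cons] at hA
    rcases hA with rfl | hA
    · exact out_le i hi j hj hij
    · rw [out_same A (hK A hA) (by simp [hA]) i hi j hj]
      exact (hs.out_le A (hK A hA) i hi j hj hij).trans hle
  · intro i j
    have : ((i ∈ I ∧ j ∈ J) ∨ (i ∈ J ∧ j ∈ I)) ↔ ((j ∈ I ∧ i ∈ J) ∨ (j ∈ J ∧ i ∈ I)) := by tauto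
    simp only [LWState.merge, this, hs.out_symm i j]
  · intro A hA i hi j hj k hk hij hjk hik
    rw [(merge_clusters_perm her).mem_iff, List.mem_cons] at hA
    have of_mem : ∀ B ∈ s.clusters, B = I ∨ B = J ∨ B ∈ r → i ∈ B → j ∈ B → k ∈ B →
        (s.merge p I J).out i k ≤ max ((s.merge p I J).out i j) ((s.merge p I J).out j k) := by
      intro B hB hB' hi hj hk
      rw [out_same B hB hB' i hi k hk, out_same B hB hB' i hi j hj, out_same B hB hB' j hj k hk]
      exact hs.ultra B hB i hi j hj k hk hij hjk hik
    rcases hA with rfl | hA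
    · by_cases h₁ : (i ∈ I ∧ j ∈ J) ∨ (i ∈ J ∧ j ∈ I)
      · exact le_max_of_le_left ((out_le i hi k hk hik).trans (out_cross i j h₁).ge)
      by_cases h₂ : (j ∈ I ∧ k ∈ J) ∨ (j ∈ J ∧ k ∈ I)
      · exact le_max_of_le_right ((out_le i hi k hk hik).trans (out_cross j k h₂).ge)
      rw [Finset.mem_union] at hi hj hk
      have : (i ∈ I ∧ j ∈ I ∧ k ∈ I) ∨ (i ∈ J ∧ j ∈ J ∧ k ∈ J) := by tauto
      rcases this with ⟨hi, hj, hk⟩ | ⟨hi, hj, hk⟩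
      · exact of_mem I hI (by simp) hi hj hk
      · exact of_mem J hJ (by simp) hi hj hk
    · exact of_mem A (hK A hA) (by simp [hA]) hi hj hk

theorem length_clusters_iterate_lwStep {M : ℕ} (p : LWParams) (d : Fin M → Fin M → ℝ) (n : ℕ) :
    ((lwStep p)^[n] (lwInit M d)).clusters.length ≤ 1 ∨
      ((lwStep p)^[n] (lwInit M d)).clusters.length + n ≤ M := by
  induction n with
  | zero => simp [lwInit]
  | succ n ih =>
    rw [Function.iterate_succ_apply']
    rcases lwStep_eq_self_or_merge p ((lwStep p)^[n] (lwInit M d)) with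
      ⟨h, e⟩ | ⟨I, J, r, hr, -, her, e⟩
    · exact Or.inl (by rwa [e])
    · have h₁ := hr.length_eq
      have h₂ := (LWState.merge_clusters_perm (p := p) her).length_eq
      rw [e]
      simp only [List.length_cons] at h₁ h₂
      omega

theorem lwRun_isDendrogram {M : ℕ} {p : LWParams} (hp : LWConvexParams p)
    {d : Fin M → Fin M → ℝ} (hd : IsDissim M d) : ∃ h, (lwRun M p d).IsDendrogram h := by
  have h : ∀ n, ∃ h, ((lwStep p)^[n] (lwInit M d)).IsDendrogram h := fun n => by
    induction n with
    | zero => exact ⟨0, lwInit_isDendrogram hd⟩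
    | succ n ih =>
      obtain ⟨h, ih⟩ := ih
      rw [Function.iterate_succ_apply']
      exact ih.lwStep hp
  exact h (M - 1)

theorem lwTau_symm {M : ℕ} {p : LWParams} (hp : LWConvexParams p) {d : Fin M → Fin M → ℝ}
    (hd : IsDissim M d) (i j : Fin M) : lwTau M p d i j = lwTau M p d j i := by
  obtain ⟨h, hs⟩ := lwRun_isDendrogram hp hd
  simp only [lwTau, hs.out_symm i j, eq_comm (a := i)]

theorem lwTau_isUltrametricOffDiag {M : ℕ} {p : LWParams} (hp : LWConvexParams p)
    {d : Fin M → Fin M → ℝ} (hd : IsDissim M d) : IsUltrametricOffDiag (lwTau M p d) := by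
  intro i j k hij hjk hik
  obtain ⟨h, hs⟩ := lwRun_isDendrogram hp hd
  have hlen : (lwRun M p d).clusters.length ≤ 1 := by
    rcases length_clusters_iterate_lwStep p d (M - 1) with h | h <;> rw [lwRun] <;> omega
  obtain ⟨A, hA, hi⟩ := hs.cover i
  have hmem : ∀ x, x ∈ A := fun x => by
    obtain ⟨B, hB, hx⟩ := hs.cover x
    obtain ⟨C, hC⟩ := List.length_eq_one_iff.1 (hlen.antisymm (List.length_pos_of_mem hA))
    rw [hC, List.mem_singleton] at hA hB
    rwa [hA, ← hB]
  simpa only [lwTau, if_neg hij, if_neg hjk, if_neg hik] using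
    hs.ultra A hA i hi j (hmem j) k (hmem k) hij hjk hik

/-- Lemma 3.1: if at every step `α_I, α_J ≥ 0`, `α_I + α_J = 1`, `β = 0` and
`|γ| ≤ min(α_I, α_J)`, then the Lance–Williams map `τ` is a projection:
`τ(τ(d_H)) = τ(d_H)` for every input `d_H`. -/
theorem lanceWilliams_projection (M : ℕ) (p : LWParams) (hp : LWConvexParams p)
    (dH : Fin M → Fin M → ℝ) (hdH : IsDissim M dH) :
    lwTau M p (lwTau M p dH) = lwTau M p dH := by
  exact lwTau_eq_self hp (fun i => by simp [lwTau]) (lwTau_symm hp hdH)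
    (lwTau_isUltrametricOffDiag hp hdH)
end
end

section
/- Local continuity of the Lance–Williams map at tie-free inputs: if the Lance–Williams algorithm run on an input D₀ selects a strictly unique minimizing pair at every merge step, then there is a neighborhood of D₀ (within the symmetric nonnegative matrices with zero diagonal) on which the algorithm performs the same sequence of merges as on D₀; in particular, the map τ is continuous at D₀. -/
open MeasureTheory ProbabilityTheory Filter Matrix
open scoped RealInnerProductSpace

noncomputable section

/-- A list whose values under `f` have a strict minimum at `q` has `argmin` equal to `q`. -/
theorem argmin_eq_some_of_forall_ne_lt {α : Type*} {l : List α} {f : α → ℝ} {q : α}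
    (hq : q ∈ l) (h : ∀ r ∈ l, r ≠ q → f q < f r) : l.argmin f = some q := by
  cases hm : l.argmin f with
  | none => simp [List.argmin_eq_none.mp hm] at hq
  | some m =>
    by_contra hne
    have hmq : m ≠ q := fun e => hne (by rw [e])
    exact (List.le_of_mem_argmin hq hm).not_gt (h m (List.argmin_mem hm) hmq)

/-- A family of states converges to `s₀`: the clusters are eventually those of `s₀`, and the
distances and outputs converge pointwise. -/
structure LWTendsto {M : ℕ} {X : Type*} (s : X → LWState M) (l : Filter X)
    (s₀ : LWState M) : Prop where
  clusters : ∀ᶠ x in l, (s x).clusters = s₀.clusters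
  dist : ∀ A B, Tendsto (fun x => (s x).dist A B) l (nhds (s₀.dist A B))
  out : ∀ i j, Tendsto (fun x => (s x).out i j) l (nhds (s₀.out i j))

/-- Convergence of states is preserved by a merge step with a strictly unique minimizing pair. -/
theorem LWTendsto.lwStep {M : ℕ} {X : Type*} {s : X → LWState M} {l : Filter X}
    {s₀ : LWState M} (h : LWTendsto s l s₀) (p : LWParams)
    (hmin : ∃ q ∈ pairsOf s₀.clusters, ∀ r ∈ pairsOf s₀.clusters, r ≠ q →
      s₀.dist q.1 q.2 < s₀.dist r.1 r.2) :
    LWTendsto (fun x => lwStep p (s x)) l (lwStep p s₀) := by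
  obtain ⟨q, hq, hlt⟩ := hmin
  have h₀ : (pairsOf s₀.clusters).argmin (fun q => s₀.dist q.1 q.2) = some q :=
    argmin_eq_some_of_forall_ne_lt hq hlt
  have hev : ∀ᶠ x in l, ∀ r ∈ pairsOf s₀.clusters, r ≠ q →
      (s x).dist q.1 q.2 < (s x).dist r.1 r.2 := by
    have hfin : {r | r ∈ pairsOf s₀.clusters}.Finite := List.finite_toSet _
    refine (eventually_all_finite hfin).mpr fun r hr => ?_
    by_cases hrq : r = q
    · simp [hrq]
    · filter_upwards [(h.dist q.1 q.2).eventually_lt (h.dist r.1 r.2) (hlt r hr hrq)] with x hx _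
      exact hx
  have hx : ∀ᶠ x in l, (s x).clusters = s₀.clusters ∧
      (pairsOf (s x).clusters).argmin (fun q => (s x).dist q.1 q.2) = some q := by
    filter_upwards [h.clusters, hev] with x hc hd
    refine ⟨hc, ?_⟩
    rw [hc]
    exact argmin_eq_some_of_forall_ne_lt hq hd
  refine ⟨?_, fun A B => ?_, fun i j => ?_⟩
  · filter_upwards [hx] with x hx
    simp only [_root_.lwStep, h₀, hx.1, hx.1 ▸ hx.2]
  · have key : ∀ (a b c e : ℝ) (K : Finset (Fin M)), Tendsto (fun x =>
        a * (s x).dist q.1 K + b * (s x).dist q.2 K + c * (s x).dist q.1 q.2 +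
          e * |(s x).dist q.1 K - (s x).dist q.2 K|) l
        (nhds (a * s₀.dist q.1 K + b * s₀.dist q.2 K + c * s₀.dist q.1 q.2 +
          e * |s₀.dist q.1 K - s₀.dist q.2 K|)) := fun a b c e K =>
      ((((h.dist _ _).const_mul a).add ((h.dist _ _).const_mul b)).add
        ((h.dist _ _).const_mul c)).add (((h.dist _ _).sub (h.dist _ _)).abs.const_mul e)
    simp only [_root_.lwStep, h₀]
    refine Tendsto.congr' (hx.mono fun x hx => ?_) (f₁ := fun x =>
      if A = q.1 ∪ q.2 ∧ B = q.1 ∪ q.2 then 0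
      else if A = q.1 ∪ q.2 then
        p.αI q.1.card q.2.card B.card * (s x).dist q.1 B +
          p.αJ q.1.card q.2.card B.card * (s x).dist q.2 B +
          p.β q.1.card q.2.card B.card * (s x).dist q.1 q.2 +
          p.γ q.1.card q.2.card B.card * |(s x).dist q.1 B - (s x).dist q.2 B|
      else if B = q.1 ∪ q.2 then
        p.αI q.1.card q.2.card A.card * (s x).dist q.1 A +
          p.αJ q.1.card q.2.card A.card * (s x).dist q.2 A +
          p.β q.1.card q.2.card A.card * (s x).dist q.1 q.2 +
          p.γ q.1.card q.2.card A.card * |(s x).dist q.1 A - (s x).dist q.2 A|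
      else (s x).dist A B) ?_
    · simp only [hx.2]
    · split_ifs
      · exact tendsto_const_nhds
      · exact key _ _ _ _ B
      · exact key _ _ _ _ A
      · exact h.dist A B
  · simp only [_root_.lwStep, h₀]
    refine Tendsto.congr' (hx.mono fun x hx => ?_) (f₁ := fun x =>
      if (i ∈ q.1 ∧ j ∈ q.2) ∨ (i ∈ q.2 ∧ j ∈ q.1) then (s x).dist q.1 q.2
      else (s x).out i j) ?_
    · simp only [hx.2]
    · split_ifs
      · exact h.dist _ _
      · exact h.out i j

/-- The initial state depends continuously on the input dissimilarity. -/
theorem lwTendsto_lwInit (M : ℕ) (D₀ : Fin M → Fin M → ℝ) :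
    LWTendsto (lwInit M) (nhds D₀) (lwInit M D₀) where
  clusters := Eventually.of_forall fun _ => rfl
  dist A B := by
    have : Continuous fun D : Fin M → Fin M → ℝ => ∑ i ∈ A, ∑ j ∈ B, D i j := by fun_prop
    exact this.tendsto D₀
  out i j := by
    have : Continuous fun D : Fin M → Fin M → ℝ => D i j := by fun_prop
    exact this.tendsto D₀

/-- At a tie-free input, every intermediate state depends continuously on the input. -/
theorem lwTendsto_iterate {M : ℕ} {p : LWParams} {D₀ : Fin M → Fin M → ℝ}
    (hties : lwNoTies M p D₀) (k : ℕ) (hk : k ≤ M - 1) :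
    LWTendsto (fun D => (lwStep p)^[k] (lwInit M D)) (nhds D₀)
      ((lwStep p)^[k] (lwInit M D₀)) := by
  induction k with
  | zero => exact lwTendsto_lwInit M D₀
  | succ k ih =>
    simp only [Function.iterate_succ_apply']
    exact (ih (by omega)).lwStep p (hties k (by omega))

/-- Local continuity of the Lance–Williams map at tie-free inputs: if the algorithm run on
`D₀` selects a strictly unique minimizing pair at every merge step, then on a neighborhood
of `D₀` (within the symmetric nonnegative matrices with zero diagonal) the algorithm performs
the same sequence of merges as on `D₀`; in particular `τ` is continuous at `D₀`. -/
theorem lanceWilliams_locally_constant_merges (M : ℕ) (p : LWParams)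
    (D₀ : Fin M → Fin M → ℝ) (hD₀ : IsDissim M D₀) (hties : lwNoTies M p D₀) :
    (∃ ε > (0 : ℝ), ∀ D : Fin M → Fin M → ℝ, IsDissim M D →
      (∀ i j, |D i j - D₀ i j| < ε) → ∀ k ≤ M - 1,
        ((lwStep p)^[k] (lwInit M D)).clusters = ((lwStep p)^[k] (lwInit M D₀)).clusters) ∧
    ContinuousWithinAt (lwTau M p) {D | IsDissim M D} D₀ := by
  constructor
  · have hev : ∀ᶠ D in nhds D₀, ∀ k ∈ Set.Iic (M - 1),
        ((lwStep p)^[k] (lwInit M D)).clusters = ((lwStep p)^[k] (lwInit M D₀)).clusters :=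
      (eventually_all_finite (Set.finite_Iic _)).mpr fun k hk =>
        (lwTendsto_iterate hties k hk).clusters
    obtain ⟨ε, hε, h⟩ := Metric.eventually_nhds_iff.mp hev
    refine ⟨ε, hε, fun D _ hD => h ?_⟩
    exact (dist_pi_lt_iff hε).mpr fun i => (dist_pi_lt_iff hε).mpr fun j => hD i j
  · refine ContinuousAt.continuousWithinAt ?_
    refine tendsto_pi_nhds.mpr fun i => tendsto_pi_nhds.mpr fun j => ?_
    unfold lwTau
    split_ifs
    · exact tendsto_const_nhds
    · exact (lwTendsto_iterate hties (M - 1) le_rfl).out i j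
end
end

section
/- Local linearity of the Lance–Williams map when γ = 0: suppose γ = 0 and the algorithm run on an input D₀ selects a strictly unique minimizing pair at every merge step. Then there are a neighborhood of D₀ and a fixed matrix A ∈ ℝ^{d×d} (with d = M(M−1)/2, using upper-triangular vectorization of symmetric matrices) such that τ(D) = AD for every D in that neighborhood. -/
open MeasureTheory ProbabilityTheory Filter Matrix
open scoped RealInnerProductSpace

noncomputable section

theorem List.argmin_eq_some_of_forall_lt {α : Type*} {f : α → ℝ} {l : List α} {q : α}
    (hq : q ∈ l) (h : ∀ r ∈ l, r ≠ q → f q < f r) : l.argmin f = some q := by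
  cases hm : l.argmin f with
  | none => simp [List.argmin_eq_none.mp hm] at hq
  | some m =>
    by_contra hne
    exact absurd (h m (List.argmin_mem hm) fun e => hne (by rw [e]))
      (not_lt.mpr (List.le_of_mem_argmin hq hm))

/-- Near a tie-free input, the state after `k` merges has a constant list of clusters, and its
inter-cluster distances and recorded heights are linear in the input. -/
theorem eventually_lwStep_iterate_eq_linear {M : ℕ} {p : LWParams}
    (hγ : ∀ nI nJ nK, p.γ nI nJ nK = 0)
    {D₀ : Fin M → Fin M → ℝ} (hties : lwNoTies M p D₀) (k : ℕ) (hk : k ≤ M - 1) :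
    ∃ (C : List (Finset (Fin M)))
      (L : Finset (Fin M) → Finset (Fin M) → (Fin M → Fin M → ℝ) →ₗ[ℝ] ℝ)
      (O : Fin M → Fin M → (Fin M → Fin M → ℝ) →ₗ[ℝ] ℝ),
      ∀ᶠ D in nhds D₀, (lwStep p)^[k] (lwInit M D) =
        { clusters := C, dist := fun A B => L A B D, out := fun i j => O i j D } := by
  induction k with
  | zero =>
    refine ⟨(List.finRange M).map fun i => {i},
      fun A B => ∑ i ∈ A, ∑ j ∈ B, LinearMap.proj j ∘ₗ LinearMap.proj i,
      fun i j => LinearMap.proj j ∘ₗ LinearMap.proj i, .of_forall fun D => ?_⟩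
    simp [lwInit]
  | succ k ih =>
    obtain ⟨C, L, O, hD⟩ := ih (by omega)
    obtain ⟨q, hq, hlt⟩ := hties k (by omega)
    rw [hD.self_of_nhds] at hq hlt
    have hmin : ∀ᶠ D in nhds D₀, ∀ r ∈ pairsOf C, r ≠ q → L q.1 q.2 D < L r.1 r.2 D := by
      refine (Filter.eventually_all_finite (List.finite_toSet (pairsOf C))).mpr fun r hr => ?_
      by_cases hrq : r = q
      · exact .of_forall fun D h => absurd hrq h
      · filter_upwards [(L q.1 q.2).continuous_of_finiteDimensional.continuousAt.eventually_lt
          (L r.1 r.2).continuous_of_finiteDimensional.continuousAt (hlt r hr hrq)] with D h _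
        exact h
    refine ⟨(q.1 ∪ q.2) :: ((C.erase q.1).erase q.2),
      fun A B =>
        if A = q.1 ∪ q.2 ∧ B = q.1 ∪ q.2 then 0
        else if A = q.1 ∪ q.2 then
          p.αI q.1.card q.2.card B.card • L q.1 B + p.αJ q.1.card q.2.card B.card • L q.2 B +
            p.β q.1.card q.2.card B.card • L q.1 q.2
        else if B = q.1 ∪ q.2 then
          p.αI q.1.card q.2.card A.card • L q.1 A + p.αJ q.1.card q.2.card A.card • L q.2 A +
            p.β q.1.card q.2.card A.card • L q.1 q.2
        else L A B,
      fun i j => if (i ∈ q.1 ∧ j ∈ q.2) ∨ (i ∈ q.2 ∧ j ∈ q.1) then L q.1 q.2 else O i j, ?_⟩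
    filter_upwards [hD, hmin] with D hD hmin
    have harg : (pairsOf C).argmin (fun r => L r.1 r.2 D) = some q :=
      List.argmin_eq_some_of_forall_lt hq hmin
    rw [Function.iterate_succ_apply', hD]
    simp only [lwStep, harg, hγ, zero_mul, add_zero, LWState.mk.injEq, true_and]
    constructor
    · funext A B
      split_ifs <;> simp
    · funext i j
      split_ifs <;> rfl

/-- The symmetric matrix with zero diagonal whose strictly upper triangular entries, enumerated
by `e`, are the given vector. -/
def symmOfUpper {M d : ℕ} (e : Fin d ≃ {q : Fin M × Fin M // q.1 < q.2}) :
    (Fin d → ℝ) →ₗ[ℝ] (Fin M → Fin M → ℝ) where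
  toFun v i j :=
    if h : i < j then v (e.symm ⟨(i, j), h⟩)
    else if h : j < i then v (e.symm ⟨(j, i), h⟩) else 0
  map_add' v w := by
    funext i j
    simp only [Pi.add_apply]
    split_ifs <;> simp
  map_smul' c v := by
    funext i j
    simp only [Pi.smul_apply, RingHom.id_apply]
    split_ifs <;> simp

theorem symmOfUpper_vec {M d : ℕ} (e : Fin d ≃ {q : Fin M × Fin M // q.1 < q.2})
    {D : Fin M → Fin M → ℝ} (hD : IsDissim M D) :
    symmOfUpper e (fun k => D (e k).1.1 (e k).1.2) = D := by
  obtain ⟨-, hdiag, hsymm⟩ := hD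
  funext i j
  rcases lt_trichotomy i j with h | rfl | h
  · simp [symmOfUpper, h]
  · simp [symmOfUpper, hdiag]
  · simp [symmOfUpper, h, h.not_gt, hsymm i j]

/-- Local linearity of the Lance–Williams map when `γ = 0`: if the algorithm run on `D₀`
is tie-free, then there are a neighborhood of `D₀` and a fixed matrix
`A : ℝ^{d×d}` (`d = M(M−1)/2`, upper-triangular vectorization) with `τ(D) = A·D` on it. -/
theorem lanceWilliams_locally_linear (M : ℕ) (p : LWParams)
    (hγ : ∀ nI nJ nK, p.γ nI nJ nK = 0)
    (D₀ : Fin M → Fin M → ℝ) (hD₀ : IsDissim M D₀) (hties : lwNoTies M p D₀)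
    (e : Fin (M * (M - 1) / 2) ≃ {q : Fin M × Fin M // q.1 < q.2}) :
    ∃ ε > (0 : ℝ), ∃ A : Matrix (Fin (M * (M - 1) / 2)) (Fin (M * (M - 1) / 2)) ℝ,
      ∀ D : Fin M → Fin M → ℝ, IsDissim M D → (∀ i j, |D i j - D₀ i j| < ε) →
        (fun k => lwTau M p D (e k).1.1 (e k).1.2) =
          A.mulVec (fun k => D (e k).1.1 (e k).1.2) := by
  obtain ⟨C, L, O, hO⟩ := eventually_lwStep_iterate_eq_linear hγ hties (M - 1) le_rfl
  obtain ⟨ε, hε, hball⟩ := Metric.eventually_nhds_iff.mp hO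
  refine ⟨ε, hε, LinearMap.toMatrix'
    (LinearMap.pi fun k => O (e k).1.1 (e k).1.2 ∘ₗ symmOfUpper e), fun D hD hclose => ?_⟩
  have hrun : lwRun M p D = _ := hball ((dist_pi_lt_iff hε).mpr fun i =>
    (dist_pi_lt_iff hε).mpr fun j => (Real.dist_eq _ _).trans_lt (hclose i j))
  funext k
  rw [LinearMap.toMatrix'_mulVec]
  simp [lwTau, hrun, (e k).2.ne, symmOfUpper_vec e hD]
end
end

section
/- The Lance–Williams output is an ultrametric: suppose that at every step the parameters satisfy α_I, α_J ≥ 0, α_I + α_J = 1, β = 0 and |γ| ≤ min(α_I, α_J). Then for every input d_H, the sequence of merge heights d(I,J) selected at successive steps of the algorithm is nondecreasing, and the output τ(d_H) is a pseudo-ultrametric. -/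
open MeasureTheory ProbabilityTheory Filter Matrix
open scoped RealInnerProductSpace

noncomputable section

/-- A pseudo-ultrametric: symmetric, nonnegative, zero diagonal, and
`u(i,k) ≤ max (u(i,j)) (u(j,k))`. -/
def IsPseudoUltrametric (M : ℕ) (u : Fin M → Fin M → ℝ) : Prop :=
  (∀ i j, 0 ≤ u i j) ∧ (∀ i, u i i = 0) ∧ (∀ i j, u i j = u j i) ∧
    ∀ i j k, u i k ≤ max (u i j) (u j k)

/-- The merge height `d(I, J)` selected at step `k` of the Lance–Williams algorithm. -/
def lwHeight (M : ℕ) (p : LWParams) (dH : Fin M → Fin M → ℝ) (k : ℕ) : ℝ :=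
  match (pairsOf ((lwStep p)^[k] (lwInit M dH)).clusters).argmin
      (fun q => ((lwStep p)^[k] (lwInit M dH)).dist q.1 q.2) with
  | none => 0
  | some q => ((lwStep p)^[k] (lwInit M dH)).dist q.1 q.2

theorem mem_of_mem_pairsOf {α : Type*} {l : List α} {q : α × α} (hq : q ∈ pairsOf l) :
    q.1 ∈ l ∧ q.2 ∈ l := by
  induction l with
  | nil => simp [pairsOf] at hq
  | cons a l ih =>
    simp only [pairsOf, List.mem_append, List.mem_map] at hq
    rcases hq with ⟨b, hb, rfl⟩ | hq
    · simp [hb]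
    · simp [ih hq]

theorem ne_of_mem_pairsOf {α : Type*} {l : List α} (hl : l.Nodup) {q : α × α}
    (hq : q ∈ pairsOf l) : q.1 ≠ q.2 := by
  induction l with
  | nil => simp [pairsOf] at hq
  | cons a l ih =>
    simp only [pairsOf, List.mem_append, List.mem_map] at hq
    rw [List.nodup_cons] at hl
    rcases hq with ⟨b, hb, rfl⟩ | hq
    · exact fun hab : a = b => hl.1 (hab ▸ hb)
    · exact ih hl.2 hq

theorem mem_pairsOf_or_swap_mem {α : Type*} {l : List α} {a b : α} (ha : a ∈ l) (hb : b ∈ l)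
    (hab : a ≠ b) : (a, b) ∈ pairsOf l ∨ (b, a) ∈ pairsOf l := by
  induction l with
  | nil => simp at ha
  | cons c l ih =>
    simp only [pairsOf, List.mem_append, List.mem_map, Prod.mk.injEq]
    rcases List.mem_cons.1 ha with hac | ha' <;> rcases List.mem_cons.1 hb with hbc | hb'
    · exact absurd (hac.trans hbc.symm) hab
    · exact Or.inl (Or.inl ⟨b, hb', hac.symm, rfl⟩)
    · exact Or.inr (Or.inl ⟨a, ha', hbc.symm, rfl⟩)
    · exact (ih ha' hb').imp Or.inr Or.inr

theorem pairsOf_ne_nil {α : Type*} {l : List α} (hl : 2 ≤ l.length) : pairsOf l ≠ [] := by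
  match l, hl with
  | a :: b :: l, _ => simp [pairsOf]

/-- A Lance–Williams update with convex weights, `β = 0` and `|γ| ≤ min αI αJ` stays above every
common lower bound of the two updated distances. -/
theorem le_lanceWilliams_update {a b c x y t m : ℝ} (hab : a + b = 1)
    (hc : |c| ≤ min a b) (hx : m ≤ x) (hy : m ≤ y) :
    m ≤ a * x + b * y + 0 * t + c * |x - y| := by
  have hca := (neg_abs_le c).trans' (neg_le_neg (hc.trans (min_le_left _ _)))
  have hcb := (neg_abs_le c).trans' (neg_le_neg (hc.trans (min_le_right _ _)))
  obtain rfl : b = 1 - a := by linarith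
  rcases le_total x y with h | h
  · rw [abs_of_nonpos (sub_nonpos.2 h)]
    nlinarith [mul_nonneg (sub_nonneg.2 hcb) (sub_nonneg.2 h)]
  · rw [abs_of_nonneg (sub_nonneg.2 h)]
    nlinarith [mul_nonneg (sub_nonneg.2 hca) (sub_nonneg.2 h)]

/-- The state obtained from `s` by merging the clusters `I` and `J`. -/
def lwMerge {M : ℕ} (p : LWParams) (s : LWState M) (I J : Finset (Fin M)) : LWState M where
  clusters := (I ∪ J) :: ((s.clusters.erase I).erase J)
  dist := fun A B =>
    if A = I ∪ J ∧ B = I ∪ J then 0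
    else if A = I ∪ J then
      p.αI I.card J.card B.card * s.dist I B + p.αJ I.card J.card B.card * s.dist J B +
        p.β I.card J.card B.card * s.dist I J +
        p.γ I.card J.card B.card * |s.dist I B - s.dist J B|
    else if B = I ∪ J then
      p.αI I.card J.card A.card * s.dist I A + p.αJ I.card J.card A.card * s.dist J A +
        p.β I.card J.card A.card * s.dist I J +
        p.γ I.card J.card A.card * |s.dist I A - s.dist J A|
    else s.dist A B
  out := fun i j => if (i ∈ I ∧ j ∈ J) ∨ (i ∈ J ∧ j ∈ I) then s.dist I J else s.out i j

theorem lwStep_eq_lwMerge {M : ℕ} (p : LWParams) (s : LWState M)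
    {q : Finset (Fin M) × Finset (Fin M)}
    (hq : (pairsOf s.clusters).argmin (fun q => s.dist q.1 q.2) = some q) :
    lwStep p s = lwMerge p s q.1 q.2 := by
  unfold lwStep
  rw [hq]
  rfl

/-- The loop invariant of the algorithm: the clusters partition the points, distinct clusters are
at distance at least `h`, and the output restricted to each cluster is a pseudo-ultrametric bounded
by `h`. -/
structure LWInvariant {M : ℕ} (s : LWState M) (h : ℝ) : Prop where
  nodup : s.clusters.Nodup
  nonempty : ∀ A ∈ s.clusters, A.Nonempty
  disjoint : ∀ A ∈ s.clusters, ∀ B ∈ s.clusters, A ≠ B → Disjoint A B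
  cover : ∀ i, ∃ A ∈ s.clusters, i ∈ A
  dist_symm : ∀ A B, s.dist A B = s.dist B A
  le_dist : ∀ A ∈ s.clusters, ∀ B ∈ s.clusters, A ≠ B → h ≤ s.dist A B
  bound_nonneg : 0 ≤ h
  out_self : ∀ i, s.out i i = 0
  out_symm : ∀ i j, s.out i j = s.out j i
  out_nonneg : ∀ i j, 0 ≤ s.out i j
  out_le : ∀ A ∈ s.clusters, ∀ i ∈ A, ∀ j ∈ A, s.out i j ≤ h
  out_ultra : ∀ A ∈ s.clusters, ∀ i ∈ A, ∀ j ∈ A, ∀ k ∈ A,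
    s.out i k ≤ max (s.out i j) (s.out j k)

theorem lwInvariant_lwInit {M : ℕ} {dH : Fin M → Fin M → ℝ} (hdH : IsDissim M dH) :
    LWInvariant (lwInit M dH) 0 := by
  obtain ⟨h0, hs, hsymm⟩ := hdH
  refine ⟨(List.nodup_finRange M).map Finset.singleton_injective, ?_, ?_, ?_, ?_, ?_, le_rfl, hs,
    hsymm, h0, ?_, ?_⟩
  · simp [lwInit]
  · simp [lwInit, eq_comm]
  · simp [lwInit]
  · intro A B
    simp only [lwInit]
    rw [Finset.sum_comm]
    simp only [hsymm]
  · simp [lwInit, h0]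
  · simp [lwInit, hs]
  · simp [lwInit, hs]

theorem LWInvariant.lwMerge {M : ℕ} {p : LWParams} (hp : LWConvexParams p) {s : LWState M} {h : ℝ}
    (hs : LWInvariant s h) {I J : Finset (Fin M)} (hI : I ∈ s.clusters) (hJ : J ∈ s.clusters)
    (hIJ : I ≠ J)
    (hmin : ∀ A ∈ s.clusters, ∀ B ∈ s.clusters, A ≠ B → s.dist I J ≤ s.dist A B) :
    LWInvariant (lwMerge p s I J) (s.dist I J) := by
  have hdisj := hs.disjoint I hI J hJ hIJ
  have hh : h ≤ s.dist I J := hs.le_dist I hI J hJ hIJ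
  have hm0 : 0 ≤ s.dist I J := hs.bound_nonneg.trans hh
  have hmem : ∀ A, A ∈ (s.clusters.erase I).erase J ↔ A ≠ J ∧ A ≠ I ∧ A ∈ s.clusters := by
    intro A
    rw [(hs.nodup.erase I).mem_erase_iff, hs.nodup.mem_erase_iff]
  have hne : ∀ A ∈ (s.clusters.erase I).erase J, A ≠ I ∪ J := by
    rintro A hA rfl
    obtain ⟨-, hAI, hA⟩ := (hmem _).1 hA
    obtain ⟨x, hx⟩ := hs.nonempty I hI
    exact Finset.disjoint_left.1 (hs.disjoint _ hA I hI hAI) (Finset.mem_union_left _ hx) hx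
  have hdisjU : ∀ A ∈ (s.clusters.erase I).erase J, Disjoint (I ∪ J) A := by
    intro A hA
    obtain ⟨hAJ, hAI, hA⟩ := (hmem _).1 hA
    exact Finset.disjoint_union_left.2
      ⟨hs.disjoint I hI A hA hAI.symm, hs.disjoint J hJ A hA hAJ.symm⟩
  have hupd : ∀ A ∈ (s.clusters.erase I).erase J, s.dist I J ≤
      p.αI I.card J.card A.card * s.dist I A + p.αJ I.card J.card A.card * s.dist J A +
        p.β I.card J.card A.card * s.dist I J +
        p.γ I.card J.card A.card * |s.dist I A - s.dist J A| := by
    intro A hA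
    obtain ⟨hAJ, hAI, hA⟩ := (hmem _).1 hA
    obtain ⟨-, -, hα, hβ, hγ⟩ := hp I.card J.card A.card
    rw [hβ]
    exact le_lanceWilliams_update hα hγ (hmin I hI A hA hAI.symm) (hmin J hJ A hA hAJ.symm)
  have hold : ∀ A ∈ s.clusters, ∀ i ∈ A, ∀ j ∈ A, (_root_.lwMerge p s I J).out i j = s.out i j := by
    intro A hA i hi j hj
    refine if_neg ?_
    have hAI : ∀ x ∈ A, x ∈ I → A = I := fun x hx hxI => by
      by_contra hc
      exact Finset.disjoint_left.1 (hs.disjoint A hA I hI hc) hx hxI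
    have hAJ : ∀ x ∈ A, x ∈ J → A = J := fun x hx hxJ => by
      by_contra hc
      exact Finset.disjoint_left.1 (hs.disjoint A hA J hJ hc) hx hxJ
    rintro (⟨h1, h2⟩ | ⟨h1, h2⟩)
    · exact hIJ ((hAI i hi h1).symm.trans (hAJ j hj h2))
    · exact hIJ ((hAI j hj h2).symm.trans (hAJ i hi h1))
  have hIJout : ∀ i ∈ I, ∀ j ∈ J, (_root_.lwMerge p s I J).out i j = s.dist I J :=
    fun i hi j hj => if_pos (Or.inl ⟨hi, hj⟩)
  have hJIout : ∀ i ∈ J, ∀ j ∈ I, (_root_.lwMerge p s I J).out i j = s.dist I J :=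
    fun i hi j hj => if_pos (Or.inr ⟨hi, hj⟩)
  have hle : ∀ A ∈ s.clusters, ∀ i ∈ A, ∀ j ∈ A,
      (_root_.lwMerge p s I J).out i j ≤ s.dist I J := by
    intro A hA i hi j hj
    rw [hold A hA i hi j hj]
    exact (hs.out_le A hA i hi j hj).trans hh
  have hultra : ∀ A ∈ s.clusters, ∀ i ∈ A, ∀ j ∈ A, ∀ k ∈ A, (_root_.lwMerge p s I J).out i k ≤
      max ((_root_.lwMerge p s I J).out i j) ((_root_.lwMerge p s I J).out j k) := by
    intro A hA i hi j hj k hk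
    rw [hold A hA i hi k hk, hold A hA i hi j hj, hold A hA j hj k hk]
    exact hs.out_ultra A hA i hi j hj k hk
  refine ⟨?_, ?_, ?_, ?_, ?_, ?_, hm0, ?_, ?_, ?_, ?_, ?_⟩
  · exact List.nodup_cons.2 ⟨fun hU => hne _ hU rfl, (hs.nodup.erase I).erase J⟩
  · refine List.forall_mem_cons.2 ⟨(hs.nonempty I hI).mono Finset.subset_union_left, ?_⟩
    exact fun A hA => hs.nonempty A ((hmem A).1 hA).2.2
  · intro A hA B hB hAB
    rcases List.mem_cons.1 hA with rfl | hA <;> rcases List.mem_cons.1 hB with rfl | hB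
    · exact absurd rfl hAB
    · exact hdisjU B hB
    · exact (hdisjU A hA).symm
    · exact hs.disjoint A ((hmem A).1 hA).2.2 B ((hmem B).1 hB).2.2 hAB
  · intro i
    obtain ⟨A, hA, hi⟩ := hs.cover i
    by_cases hAI : A = I
    · exact ⟨I ∪ J, List.mem_cons_self, Finset.mem_union_left _ (hAI ▸ hi)⟩
    by_cases hAJ : A = J
    · exact ⟨I ∪ J, List.mem_cons_self, Finset.mem_union_right _ (hAJ ▸ hi)⟩
    exact ⟨A, List.mem_cons_of_mem _ ((hmem A).2 ⟨hAJ, hAI, hA⟩), hi⟩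
  · intro A B
    by_cases hA : A = I ∪ J <;> by_cases hB : B = I ∪ J <;>
      simp [_root_.lwMerge, hA, hB, hs.dist_symm A B]
  · intro A hA B hB hAB
    rcases List.mem_cons.1 hA with rfl | hA <;> rcases List.mem_cons.1 hB with rfl | hB
    · exact absurd rfl hAB
    · simpa only [_root_.lwMerge, hne B hB, and_false, if_false, if_true] using hupd B hB
    · simpa only [_root_.lwMerge, hne A hA, false_and, if_false, if_true] using hupd A hA
    · simpa only [_root_.lwMerge, hne A hA, hne B hB, false_and, if_false] using
        hmin A ((hmem A).1 hA).2.2 B ((hmem B).1 hB).2.2 hAB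
  · intro i
    obtain ⟨A, hA, hi⟩ := hs.cover i
    rw [hold A hA i hi i hi, hs.out_self]
  · intro i j
    simp only [_root_.lwMerge, hs.out_symm i j]
    congr 1
    exact propext (by tauto)
  · intro i j
    simp only [_root_.lwMerge]
    split_ifs
    exacts [hm0, hs.out_nonneg i j]
  · intro A hA i hi j hj
    rcases List.mem_cons.1 hA with rfl | hA
    · rcases Finset.mem_union.1 hi with hi | hi <;> rcases Finset.mem_union.1 hj with hj | hj
      · exact hle I hI i hi j hj
      · exact (hIJout i hi j hj).le
      · exact (hJIout i hi j hj).le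
      · exact hle J hJ i hi j hj
    · exact hle A ((hmem A).1 hA).2.2 i hi j hj
  · intro A hA i hi j hj k hk
    rcases List.mem_cons.1 hA with rfl | hA
    · rcases Finset.mem_union.1 hi with hi | hi <;> rcases Finset.mem_union.1 hj with hj | hj <;>
        rcases Finset.mem_union.1 hk with hk | hk
      · exact hultra I hI i hi j hj k hk
      · exact le_max_of_le_right ((hIJout i hi k hk).trans (hIJout j hj k hk).symm).le
      · exact le_max_of_le_left ((hle I hI i hi k hk).trans_eq (hIJout i hi j hj).symm)
      · exact le_max_of_le_left ((hIJout i hi k hk).trans (hIJout i hi j hj).symm).le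
      · exact le_max_of_le_left ((hJIout i hi k hk).trans (hJIout i hi j hj).symm).le
      · exact le_max_of_le_left ((hle J hJ i hi k hk).trans_eq (hJIout i hi j hj).symm)
      · exact le_max_of_le_right ((hJIout i hi k hk).trans (hJIout j hj k hk).symm).le
      · exact hultra J hJ i hi j hj k hk
    · exact hultra A ((hmem A).1 hA).2.2 i hi j hj k hk

/-- While at least two clusters remain, a step merges two of them at their minimal distance: the
cluster count drops by one and the invariant holds with the merge height as new bound. -/
theorem LWInvariant.exists_step {M : ℕ} {p : LWParams} (hp : LWConvexParams p) {s : LWState M}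
    {h : ℝ} (hs : LWInvariant s h) (hlen : 2 ≤ s.clusters.length) :
    ∃ q, (pairsOf s.clusters).argmin (fun q => s.dist q.1 q.2) = some q ∧ h ≤ s.dist q.1 q.2 ∧
      (lwStep p s).clusters.length + 1 = s.clusters.length ∧
      LWInvariant (lwStep p s) (s.dist q.1 q.2) := by
  obtain ⟨q, hq⟩ := Option.ne_none_iff_exists'.1
    (mt List.argmin_eq_none.1 (pairsOf_ne_nil hlen) :
      (pairsOf s.clusters).argmin (fun q => s.dist q.1 q.2) ≠ none)
  have hqm := List.argmin_mem hq
  obtain ⟨hI, hJ⟩ := mem_of_mem_pairsOf hqm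
  have hIJ := ne_of_mem_pairsOf hs.nodup hqm
  refine ⟨q, hq, hs.le_dist _ hI _ hJ hIJ, ?_, ?_⟩
  · have hJ' : q.2 ∈ s.clusters.erase q.1 := (List.mem_erase_of_ne hIJ.symm).2 hJ
    rw [lwStep_eq_lwMerge p s hq]
    simp only [_root_.lwMerge, List.length_cons, List.length_erase_of_mem hJ',
      List.length_erase_of_mem hI]
    omega
  · rw [lwStep_eq_lwMerge p s hq]
    refine hs.lwMerge hp hI hJ hIJ fun A hA B hB hAB => ?_
    rcases mem_pairsOf_or_swap_mem hA hB hAB with hm | hm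
    · exact List.le_of_mem_argmin hm hq
    · rw [hs.dist_symm A B]
      exact List.le_of_mem_argmin hm hq

theorem exists_lwInvariant_iterate {M : ℕ} {p : LWParams} (hp : LWConvexParams p)
    {dH : Fin M → Fin M → ℝ} (hdH : IsDissim M dH) (k : ℕ) (hk : k ≤ M - 1) :
    ((lwStep p)^[k] (lwInit M dH)).clusters.length + k = M ∧
      ∃ h, LWInvariant ((lwStep p)^[k] (lwInit M dH)) h := by
  induction k with
  | zero => exact ⟨by simp [lwInit], 0, lwInvariant_lwInit hdH⟩
  | succ k ih =>
    obtain ⟨hlen, h, hs⟩ := ih (by omega)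
    obtain ⟨q, -, -, hlen', hs'⟩ := hs.exists_step hp (by omega)
    rw [Function.iterate_succ_apply']
    exact ⟨by omega, _, hs'⟩

theorem lwHeight_eq {M : ℕ} {p : LWParams} {dH : Fin M → Fin M → ℝ} {k : ℕ}
    {q : Finset (Fin M) × Finset (Fin M)}
    (hq : (pairsOf ((lwStep p)^[k] (lwInit M dH)).clusters).argmin
      (fun q => ((lwStep p)^[k] (lwInit M dH)).dist q.1 q.2) = some q) :
    lwHeight M p dH k = ((lwStep p)^[k] (lwInit M dH)).dist q.1 q.2 := by
  unfold lwHeight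
  rw [hq]

/-- Under the parameter conditions `α_I, α_J ≥ 0`, `α_I + α_J = 1`, `β = 0`,
`|γ| ≤ min(α_I, α_J)`: for every input, the successive merge heights are nondecreasing and
the output of the Lance–Williams algorithm is a pseudo-ultrametric. -/
theorem lanceWilliams_output_ultrametric (M : ℕ) (p : LWParams) (hp : LWConvexParams p)
    (dH : Fin M → Fin M → ℝ) (hdH : IsDissim M dH) :
    (∀ k : ℕ, k + 1 < M - 1 → lwHeight M p dH k ≤ lwHeight M p dH (k + 1)) ∧
    IsPseudoUltrametric M (lwTau M p dH) := by
  refine ⟨fun k hk => ?_, ?_⟩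
  · obtain ⟨hlen, h, hs⟩ := exists_lwInvariant_iterate hp hdH k (by omega)
    obtain ⟨q, hq, -, hlen', hs'⟩ := hs.exists_step hp (by omega)
    rw [← Function.iterate_succ_apply' (lwStep p)] at hlen' hs'
    obtain ⟨r, hr, hle, -⟩ := hs'.exists_step hp (by omega)
    rwa [lwHeight_eq hq, lwHeight_eq hr]
  · obtain ⟨hlen, h, hs⟩ := exists_lwInvariant_iterate hp hdH (M - 1) le_rfl
    have hτ : lwTau M p dH = (lwRun M p dH).out := by
      funext i j
      by_cases hij : i = j
      · subst hij
        simp [lwTau, lwRun, hs.out_self]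
      · simp [lwTau, hij]
    rw [hτ]
    refine ⟨hs.out_nonneg, hs.out_self, hs.out_symm, fun i j k => ?_⟩
    have hone : ((lwStep p)^[M - 1] (lwInit M dH)).clusters.length = 1 := by
      have := i.pos
      omega
    obtain ⟨C, hC⟩ := List.length_eq_one_iff.1 hone
    have hmem : ∀ x, x ∈ C := fun x => by
      obtain ⟨A, hA, hx⟩ := hs.cover x
      rw [hC, List.mem_singleton] at hA
      exact hA ▸ hx
    exact hs.out_ultra C (by simp [hC]) i (hmem i) j (hmem j) k (hmem k)
end
end

section
/- Convexity of the union of two convex sets in opposite half-spaces (abstract form of Lemma 6.1(iii)): let E be a real inner product space, e ∈ E a unit vector, H = {x ∈ E : ⟨x,e⟩ = 0}, and π : E → H the orthogonal projection onto H. Let A ⊆ {x ∈ E : ⟨x,e⟩ ≥ 0} and B ⊆ {x ∈ E : ⟨x,e⟩ ≤ 0} be convex sets such that π(A) ⊆ A ∩ B and π(B) ⊆ A ∩ B. Then A ∪ B is a convex set. -/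
open MeasureTheory ProbabilityTheory Filter Matrix
open scoped RealInnerProductSpace

noncomputable section

/-- A convex set containing the endpoints `x` and `x - s • v` contains every `x - r • v` with
`0 ≤ r ≤ s`. -/
theorem Convex.sub_smul_mem_of_le {E : Type*} [AddCommGroup E] [Module ℝ E] {S : Set E}
    (hS : Convex ℝ S) {x v : E} {r s : ℝ} (hx : x ∈ S) (hxs : x - s • v ∈ S)
    (hr : 0 ≤ r) (hrs : r ≤ s) : x - r • v ∈ S := by
  rcases (hr.trans hrs).eq_or_lt with h0 | hs
  · obtain rfl : r = s := by linarith
    exact hxs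
  · have h := hS hx hxs (a := 1 - r / s) (b := r / s)
      (sub_nonneg.2 ((div_le_one hs).2 hrs)) (by positivity) (by ring)
    convert h using 1
    match_scalars
    · ring
    · field_simp

/-- Let `S` be convex and contain `x` together with `x - s • v` and `y - t • v`, where `t ≤ 0`.
Then `a • x + b • y ∈ S` for every convex combination with `0 ≤ a * s + b * t`. -/
theorem Convex.combo_mem_of_sub_smul_mem {E : Type*} [AddCommGroup E] [Module ℝ E] {S : Set E}
    (hS : Convex ℝ S) {x y v : E} {s t a b : ℝ} (hx : x ∈ S) (hxs : x - s • v ∈ S)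
    (hyt : y - t • v ∈ S) (ht : t ≤ 0) (ha : 0 ≤ a) (hb : 0 ≤ b) (hab : a + b = 1)
    (h : 0 ≤ a * s + b * t) : a • x + b • y ∈ S := by
  have hw : a • x + b • (y - t • v) ∈ S := hS hx hyt ha hb hab
  have hw' : (a • x + b • (y - t • v)) - (a * s) • v ∈ S := by
    convert hS hxs hyt ha hb hab using 1
    module
  convert hS.sub_smul_mem_of_le hw hw' (r := -(b * t))
    (neg_nonneg.2 (mul_nonpos_of_nonneg_of_nonpos hb ht)) (by linarith) using 1
  module

/-- Convexity of the union of two convex sets in opposite half-spaces (abstract form of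
Lemma 6.1(iii)): if `A` lies in `{⟨·,e⟩ ≥ 0}`, `B` in `{⟨·,e⟩ ≤ 0}`, both convex, and the
orthogonal projection onto the hyperplane `{⟨·,e⟩ = 0}` maps each of them into `A ∩ B`,
then `A ∪ B` is convex. -/
theorem convex_union_of_halfspaces {E : Type*} [NormedAddCommGroup E]
    [InnerProductSpace ℝ E] (e : E) (he : ‖e‖ = 1) (A B : Set E)
    (hA : Convex ℝ A) (hB : Convex ℝ B)
    (hAside : ∀ x ∈ A, (0 : ℝ) ≤ ⟪x, e⟫) (hBside : ∀ x ∈ B, ⟪x, e⟫ ≤ (0 : ℝ))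
    (hprojA : ∀ x ∈ A, x - ⟪x, e⟫ • e ∈ A ∩ B)
    (hprojB : ∀ x ∈ B, x - ⟪x, e⟫ • e ∈ A ∩ B) :
    Convex ℝ (A ∪ B) := by
  have key : ∀ x ∈ A, ∀ y ∈ B, ∀ a b : ℝ, 0 ≤ a → 0 ≤ b → a + b = 1 →
      a • x + b • y ∈ A ∪ B := by
    intro x hx y hy a b ha hb hab
    rcases le_total 0 (a * ⟪x, e⟫ + b * ⟪y, e⟫) with h | h
    · exact .inl (hA.combo_mem_of_sub_smul_mem hx (hprojA x hx).1 (hprojB y hy).1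
        (hBside y hy) ha hb hab h)
    · right
      rw [add_comm]
      refine hB.combo_mem_of_sub_smul_mem (v := -e) (s := -⟪y, e⟫) (t := -⟪x, e⟫) hy ?_ ?_
        (neg_nonpos.2 (hAside x hx)) hb ha (by linarith) (by linarith)
      · simpa only [neg_smul_neg] using (hprojB y hy).2
      · simpa only [neg_smul_neg] using (hprojA x hx).2
  rintro x (hx | hx) y (hy | hy) a b ha hb hab
  · exact .inl (hA hx hy ha hb hab)
  · exact key x hx y hy a b ha hb hab
  · rw [add_comm]
    exact key y hy x hx b a hb ha (by linarith)
  · exact .inr (hB hx hy ha hb hab)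
end
end
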